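/- Fix an integer n ≥ 1, let φ : [1,∞) → (0,∞) be an RO-varying function, and let r ≥ 0 be an integer. Then the following are equivalent: (i) ∫₁^{∞} t^{2r+n-1} · φ(t)^{-2} dt < ∞; (ii) every Lebesgue measurable function g : ℝⁿ → ℂ with ∫_{ℝⁿ} φ(⟨ξ⟩)² |g(ξ)|² dξ < ∞ satisfies ∫_{ℝⁿ} ⟨ξ⟩^{r} |g(ξ)| dξ < ∞. -/

import Mathlib

open MeasureTheory

/-- A Borel measurable function `φ : [1,∞) → (0,∞)` is RO-varying if there exist
`a > 1` and `c ≥ 1` with `c⁻¹ ≤ φ(λt)/φ(t) ≤ c` for all `t ≥ 1`, `λ ∈ [1,a]`. -/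
def IsRO (φ : ℝ → ℝ) : Prop :=
  Measurable φ ∧ (∀ t, 1 ≤ t → 0 < φ t) ∧
    ∃ a > (1 : ℝ), ∃ c ≥ (1 : ℝ), ∀ t, 1 ≤ t → ∀ l, 1 ≤ l → l ≤ a →
      c⁻¹ ≤ φ (l * t) / φ t ∧ φ (l * t) / φ t ≤ c

/-- The smoothed modulus `⟨ξ⟩ = (1 + |ξ|²)^{1/2}`. -/
noncomputable def smod {n : ℕ} (ξ : EuclideanSpace ℝ (Fin n)) : ℝ :=
  Real.sqrt (1 + ‖ξ‖ ^ 2)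

theorem IsRO.exists_dilation_bound {φ : ℝ → ℝ} (hφ : IsRO φ) (b : ℝ) :
    ∃ C ≥ (1 : ℝ), ∀ t, 1 ≤ t → ∀ l, 1 ≤ l → l ≤ b →
      φ (l * t) ≤ C * φ t ∧ φ t ≤ C * φ (l * t) := by
  obtain ⟨-, hpos, a, ha, c, hc, h⟩ := hφ
  have hc0 : 0 < c := by linarith
  have step : ∀ t, 1 ≤ t → ∀ l, 1 ≤ l → l ≤ a →
      φ (l * t) ≤ c * φ t ∧ φ t ≤ c * φ (l * t) := by
    intro t ht l hl hla
    obtain ⟨h1, h2⟩ := h t ht l hl hla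
    have hp := hpos t ht
    rw [div_le_iff₀ hp] at h2
    rw [le_div_iff₀ hp, inv_mul_le_iff₀ hc0] at h1
    exact ⟨h2, h1⟩
  have iter : ∀ k : ℕ, ∀ t, 1 ≤ t → ∀ l, 1 ≤ l → l ≤ a ^ k →
      φ (l * t) ≤ c ^ k * φ t ∧ φ t ≤ c ^ k * φ (l * t) := by
    intro k
    induction k with
    | zero =>
      intro t ht l hl hl'
      have : l = 1 := le_antisymm (by simpa using hl') hl
      simp [this]
    | succ k ih =>
      intro t ht l hl hl'
      have ha0 : 0 < a := by linarith
      set m := max 1 (l / a)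
      have hm1 : 1 ≤ m := le_max_left _ _
      have hm0 : 0 < m := by linarith
      have hml : m ≤ l := max_le hl (div_le_self (by linarith) ha.le)
      have hmk : m ≤ a ^ k :=
        max_le (one_le_pow₀ ha.le) (by rwa [div_le_iff₀ ha0, ← pow_succ])
      have hlm : l / m ≤ a := by
        rw [div_le_iff₀ hm0, mul_comm, ← div_le_iff₀ ha0]
        exact le_max_right _ _
      obtain ⟨h1, h2⟩ := ih t ht m hm1 hmk
      obtain ⟨h3, h4⟩ := step (m * t) (one_le_mul_of_one_le_of_one_le hm1 ht) (l / m)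
        ((one_le_div hm0).2 hml) hlm
      rw [← mul_assoc, div_mul_cancel₀ _ hm0.ne'] at h3 h4
      constructor
      · calc φ (l * t) ≤ c * φ (m * t) := h3
          _ ≤ c * (c ^ k * φ t) := by gcongr
          _ = c ^ (k + 1) * φ t := by ring
      · calc φ t ≤ c ^ k * φ (m * t) := h2
          _ ≤ c ^ k * (c * φ (l * t)) := by gcongr
          _ = c ^ (k + 1) * φ (l * t) := by ring
  obtain ⟨k, hk⟩ := pow_unbounded_of_one_lt b ha
  exact ⟨c ^ k, one_le_pow₀ hc, fun t ht l hl hlb => iter k t ht l hl (hlb.trans hk.le)⟩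

/-- On a σ-finite measure space of infinite measure, `L²` is not contained in `L¹`. -/
theorem exists_lintegral_sq_lt_top_lintegral_eq_top {α : Type*} [MeasurableSpace α]
    (μ : Measure α) [SigmaFinite μ] (hμ : μ Set.univ = ⊤) :
    ∃ u : α → ℝ, Measurable u ∧ (∀ x, 0 ≤ u x) ∧
      ∫⁻ x, ENNReal.ofReal (u x ^ 2) ∂μ < ⊤ ∧ ∫⁻ x, ENNReal.ofReal (u x) ∂μ = ⊤ := by
  have hS : ∀ k : ℕ, ∃ s, MeasurableSet s ∧ s ⊆ Set.univ ∧ (8 : ENNReal) ^ k < μ s ∧ μ s < ⊤ :=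
    fun k => Measure.exists_subset_measure_lt_top MeasurableSet.univ
      (hμ ▸ ENNReal.pow_lt_top (by norm_num))
  choose S hSm _ hS8 hStop using hS
  set m : ℕ → ℝ := fun k => (μ (S k)).toReal
  have hm : ∀ k, (8 : ℝ) ^ k ≤ m k := fun k => by
    have := ENNReal.toReal_mono (hStop k).ne (hS8 k).le
    simpa using this
  have hm0 : ∀ k, 0 < m k := fun k => lt_of_lt_of_le (by positivity) (hm k)
  have hmμ : ∀ k, μ (S k) = ENNReal.ofReal (m k) := fun k =>
    (ENNReal.ofReal_toReal (hStop k).ne).symm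
  set B : α → ENNReal := fun x =>
    ∑' k, (S k).indicator (fun _ => ENNReal.ofReal ((2 ^ k / m k) ^ 2)) x
  have hBm : Measurable B :=
    Measurable.tsum fun k => measurable_const.indicator (hSm k)
  have hB : ∫⁻ x, B x ∂μ < ⊤ := by
    rw [lintegral_tsum fun k => (measurable_const.indicator (hSm k)).aemeasurable]
    calc ∑' k, ∫⁻ x, (S k).indicator (fun _ => ENNReal.ofReal ((2 ^ k / m k) ^ 2)) x ∂μ
        ≤ ∑' k, ENNReal.ofReal ((1 / 2) ^ k) := by
          refine ENNReal.tsum_le_tsum fun k => ?_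
          rw [lintegral_indicator_const (hSm k), hmμ k, ← ENNReal.ofReal_mul (by positivity)]
          refine ENNReal.ofReal_le_ofReal ?_
          have h1 : (2 ^ k / m k) ^ 2 * m k = 4 ^ k / m k := by
            have := (hm0 k).ne'
            field_simp
            rw [← pow_mul, mul_comm, pow_mul]
            norm_num
          rw [h1, div_le_iff₀ (hm0 k)]
          calc (4 : ℝ) ^ k = (1 / 2) ^ k * 8 ^ k := by rw [← mul_pow]; norm_num
            _ ≤ (1 / 2) ^ k * m k := by gcongr; exact hm k
      _ = ENNReal.ofReal (∑' k : ℕ, (1 / 2 : ℝ) ^ k) :=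
          (ENNReal.ofReal_tsum_of_nonneg (fun k => by positivity)
            summable_geometric_two).symm
      _ < ⊤ := ENNReal.ofReal_lt_top
  refine ⟨fun x => √(B x).toReal, hBm.ennreal_toReal.sqrt, fun x => Real.sqrt_nonneg _, ?_, ?_⟩
  · refine (lintegral_mono fun x => ?_).trans_lt hB
    rw [Real.sq_sqrt ENNReal.toReal_nonneg]
    exact ENNReal.ofReal_toReal_le
  · have key : ∀ k : ℕ, ENNReal.ofReal (2 ^ k) ≤ ∫⁻ x, ENNReal.ofReal (√(B x).toReal) ∂μ := by
      intro k
      calc ENNReal.ofReal (2 ^ k)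
          = ∫⁻ x, (S k).indicator (fun _ => ENNReal.ofReal (2 ^ k / m k)) x ∂μ := by
            have := (hm0 k).le
            rw [lintegral_indicator_const (hSm k), hmμ k, ← ENNReal.ofReal_mul (by positivity),
              div_mul_cancel₀ _ (hm0 k).ne']
        _ ≤ _ := by
            refine lintegral_mono_ae ?_
            filter_upwards [ae_lt_top hBm hB.ne] with x hx
            by_cases hxS : x ∈ S k
            swap
            · simp [hxS]
            rw [Set.indicator_of_mem hxS]
            refine ENNReal.ofReal_le_ofReal (Real.le_sqrt_of_sq_le ?_)
            rw [← ENNReal.ofReal_le_iff_le_toReal hx.ne]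
            refine le_trans ?_ (ENNReal.le_tsum k)
            rw [Set.indicator_of_mem hxS]
    refine ENNReal.eq_top_of_forall_nnreal_le fun C => ?_
    obtain ⟨k, hk⟩ := pow_unbounded_of_one_lt (C : ℝ) one_lt_two
    refine le_trans ?_ (key k)
    rw [← ENNReal.ofReal_coe_nnreal]
    exact ENNReal.ofReal_le_ofReal hk.le

theorem measurable_smod {n : ℕ} : Measurable (smod (n := n)) := by
  unfold smod
  fun_prop

theorem one_le_smod {n : ℕ} (ξ : EuclideanSpace ℝ (Fin n)) : 1 ≤ smod ξ :=
  Real.one_le_sqrt.2 (by nlinarith [sq_nonneg ‖ξ‖])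

/-- The radial weight integral is finite iff `⟨ξ⟩ ^ (2r) φ(⟨ξ⟩)⁻²` is integrable on `ℝⁿ`. -/
theorem IsRO.lintegral_weight_lt_top_iff {n : ℕ} (hn : 1 ≤ n) {φ : ℝ → ℝ} (hφ : IsRO φ) (r : ℕ) :
    (∫⁻ t in Set.Ici (1 : ℝ), ENNReal.ofReal (t ^ (2 * r + n - 1) * (φ t)⁻¹ ^ 2)) < ⊤ ↔
    (∫⁻ ξ : EuclideanSpace ℝ (Fin n),
      ENNReal.ofReal (smod ξ ^ (2 * r) * (φ (smod ξ))⁻¹ ^ 2)) < ⊤ := by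
  have hφm := hφ.1
  have hpos := hφ.2.1
  obtain ⟨C, hC, hb⟩ := hφ.exists_dilation_bound 2
  have hC0 : 0 < C := by linarith
  have : Nonempty (Fin n) := ⟨⟨0, hn⟩⟩
  set k : ℝ → ℝ := fun t => t ^ (2 * r + n - 1) * (φ t)⁻¹ ^ 2
  set w : ℝ → ℝ := fun ρ => √(1 + ρ ^ 2) ^ (2 * r) * (φ √(1 + ρ ^ 2))⁻¹ ^ 2
  have hkm : Measurable k := by fun_prop
  have hwm : Measurable w := by fun_prop
  have hw0 : ∀ ρ, 0 ≤ w ρ := fun ρ => by positivity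
  set h : ℝ → ℝ := fun ρ => ρ ^ (n - 1) * w ρ
  have hhm : Measurable h := by fun_prop
  have inv_sq {x y : ℝ} (hx : 0 < x) (hxy : x ≤ C * y) : y⁻¹ ^ 2 ≤ C ^ 2 * x⁻¹ ^ 2 := by
    have hy : 0 < y := pos_of_mul_pos_right (hx.trans_le hxy) hC0.le
    rw [← mul_pow]
    gcongr
    rw [← div_eq_mul_inv, le_div_iff₀ hx, inv_mul_le_iff₀ hy]
    linarith
  have hdil : ∀ ρ : ℝ, 1 ≤ ρ → ρ ≤ √(1 + ρ ^ 2) ∧ √(1 + ρ ^ 2) ≤ 2 * ρ ∧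
      φ √(1 + ρ ^ 2) ≤ C * φ ρ ∧ φ ρ ≤ C * φ √(1 + ρ ^ 2) := by
    intro ρ hρ
    have h1 : ρ ≤ √(1 + ρ ^ 2) := Real.le_sqrt_of_sq_le (by linarith)
    have h2 : √(1 + ρ ^ 2) ≤ 2 * ρ := Real.sqrt_le_iff.2 ⟨by linarith, by nlinarith⟩
    have hρ0 : 0 < ρ := by linarith
    have := hb ρ hρ (√(1 + ρ ^ 2) / ρ) ((one_le_div hρ0).2 h1) ((div_le_iff₀ hρ0).2 h2)
    rw [div_mul_cancel₀ _ hρ0.ne'] at this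
    exact ⟨h1, h2, this⟩
  have hkeq : ∀ ρ, k ρ = ρ ^ (n - 1) * (ρ ^ (2 * r) * (φ ρ)⁻¹ ^ 2) := fun ρ => by
    simp only [k]
    rw [Nat.add_sub_assoc hn, pow_add]
    ring
  have hkh : ∀ ρ, 1 ≤ ρ → k ρ ≤ C ^ 2 * h ρ := by
    intro ρ hρ
    obtain ⟨h1, -, h3, -⟩ := hdil ρ hρ
    have hq := inv_sq (hpos _ (hρ.trans h1)) h3
    rw [hkeq]
    calc ρ ^ (n - 1) * (ρ ^ (2 * r) * (φ ρ)⁻¹ ^ 2)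
        ≤ ρ ^ (n - 1) * (√(1 + ρ ^ 2) ^ (2 * r) * (C ^ 2 * (φ √(1 + ρ ^ 2))⁻¹ ^ 2)) := by gcongr
      _ = C ^ 2 * h ρ := by simp only [h, w]; ring
  have hhk : ∀ ρ, 1 ≤ ρ → h ρ ≤ 2 ^ (2 * r) * C ^ 2 * k ρ := by
    intro ρ hρ
    obtain ⟨-, h2, -, h4⟩ := hdil ρ hρ
    have hq := inv_sq (hpos _ hρ) h4
    rw [hkeq]
    calc h ρ ≤ ρ ^ (n - 1) * ((2 * ρ) ^ (2 * r) * (C ^ 2 * (φ ρ)⁻¹ ^ 2)) := by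
          simp only [h, w]; gcongr
      _ = _ := by ring
  have hh1 : ∀ ρ ∈ Set.Ioc (0 : ℝ) 1, h ρ ≤ 2 ^ (2 * r) * (C ^ 2 * (φ 1)⁻¹ ^ 2) := by
    intro ρ hρ
    have h1 : 1 ≤ √(1 + ρ ^ 2) := Real.one_le_sqrt.2 (by nlinarith [sq_nonneg ρ])
    have h2 : √(1 + ρ ^ 2) ≤ 2 := Real.sqrt_le_iff.2 ⟨by norm_num, by nlinarith [hρ.1, hρ.2]⟩
    have h3 := (hb 1 le_rfl _ h1 h2).2
    rw [mul_one] at h3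
    have hq := inv_sq (hpos 1 le_rfl) h3
    calc h ρ ≤ 1 * (2 ^ (2 * r) * (C ^ 2 * (φ 1)⁻¹ ^ 2)) := by
          have := pow_le_one₀ (n := n - 1) hρ.1.le hρ.2
          simp only [h, w]; gcongr
      _ = _ := one_mul _
  have hL : (∫⁻ t in Set.Ici (1 : ℝ), ENNReal.ofReal (k t)) < ⊤ ↔ IntegrableOn k (Set.Ici 1) := by
    rw [← hasFiniteIntegral_iff_ofReal, IntegrableOn, Integrable,
      and_iff_right hkm.aestronglyMeasurable]
    filter_upwards [ae_restrict_mem measurableSet_Ici] with t ht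
    have : (0 : ℝ) ≤ t := zero_le_one.trans ht
    simp only [k, Pi.zero_apply]
    positivity
  have hR : (∫⁻ ξ : EuclideanSpace ℝ (Fin n), ENNReal.ofReal (w ‖ξ‖)) < ⊤ ↔
      IntegrableOn h (Set.Ioi 0) := by
    rw [← hasFiniteIntegral_iff_ofReal (Filter.Eventually.of_forall fun ξ => hw0 _)]
    have := integrable_fun_norm_addHaar (volume : Measure (EuclideanSpace ℝ (Fin n))) (f := w)
    simp only [finrank_euclideanSpace_fin, smul_eq_mul] at this
    rw [← this, Integrable, and_iff_right]
    exact (hwm.comp measurable_norm).aestronglyMeasurable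
  change (∫⁻ t in Set.Ici (1 : ℝ), ENNReal.ofReal (k t)) < ⊤ ↔
    (∫⁻ ξ : EuclideanSpace ℝ (Fin n), ENNReal.ofReal (w ‖ξ‖)) < ⊤
  rw [hL, hR, integrableOn_Ici_iff_integrableOn_Ioi]
  constructor
  · intro hk
    rw [← Set.Ioc_union_Ioi_eq_Ioi zero_le_one]
    refine IntegrableOn.union ?_ ?_
    · refine Measure.integrableOn_of_bounded (M := 2 ^ (2 * r) * (C ^ 2 * (φ 1)⁻¹ ^ 2))
        (by simp) hhm.aestronglyMeasurable ?_
      filter_upwards [ae_restrict_mem measurableSet_Ioc] with ρ hρ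
      rw [Real.norm_of_nonneg (mul_nonneg (pow_nonneg hρ.1.le _) (hw0 _))]
      exact hh1 ρ hρ
    · refine (hk.const_mul (2 ^ (2 * r) * C ^ 2)).mono' hhm.aestronglyMeasurable ?_
      filter_upwards [ae_restrict_mem measurableSet_Ioi] with ρ hρ
      have hρ : 1 < ρ := hρ
      rw [Real.norm_of_nonneg (mul_nonneg (pow_nonneg (by linarith) _) (hw0 _))]
      exact hhk ρ hρ.le
  · intro hh
    refine ((hh.mono_set (Set.Ioi_subset_Ioi zero_le_one)).const_mul (C ^ 2)).mono'
      hkm.aestronglyMeasurable ?_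
    filter_upwards [ae_restrict_mem measurableSet_Ioi] with ρ hρ
    have hρ : 1 < ρ := hρ
    have : 0 ≤ k ρ := by simp only [k]; positivity
    rw [Real.norm_of_nonneg this]
    exact hkh ρ hρ.le

/-- `∫₁^∞ t^{2r+n-1} φ(t)^{-2} dt < ∞` iff every measurable `g`
with finite `φ`-weighted `L²` integral satisfies `∫ ⟨ξ⟩^r |g(ξ)| dξ < ∞`. -/
theorem weight_integral_iff_weighted_L1 (n : ℕ) (hn : 1 ≤ n)
    (φ : ℝ → ℝ) (hφ : IsRO φ) (r : ℕ) :
    (∫⁻ t in Set.Ici (1 : ℝ),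
        ENNReal.ofReal (t ^ (2 * r + n - 1) * (φ t)⁻¹ ^ 2)) < ⊤ ↔
    (∀ g : EuclideanSpace ℝ (Fin n) → ℂ, Measurable g →
      (∫⁻ ξ, ENNReal.ofReal (φ (smod ξ) ^ 2 * ‖g ξ‖ ^ 2)) < ⊤ →
      (∫⁻ ξ, ENNReal.ofReal ((smod ξ) ^ r * ‖g ξ‖)) < ⊤) := by
  rw [hφ.lintegral_weight_lt_top_iff hn r]
  have hφm := hφ.1
  have hsm := measurable_smod (n := n)
  have hs : ∀ ξ : EuclideanSpace ℝ (Fin n), 0 < smod ξ :=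
    fun ξ => zero_lt_one.trans_le (one_le_smod ξ)
  have hφs : ∀ ξ : EuclideanSpace ℝ (Fin n), 0 < φ (smod ξ) :=
    fun ξ => hφ.2.1 _ (one_le_smod ξ)
  have hWm : Measurable fun ξ : EuclideanSpace ℝ (Fin n) =>
      ENNReal.ofReal (smod ξ ^ (2 * r) * (φ (smod ξ))⁻¹ ^ 2) := by fun_prop
  constructor
  · intro hW g hg hg2
    refine lt_of_le_of_lt ?_ (ENNReal.add_lt_top.2 ⟨hW, hg2⟩)
    rw [← lintegral_add_left hWm]
    refine lintegral_mono fun ξ => ?_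
    have h1 := hs ξ
    have h2 := hφs ξ
    rw [← ENNReal.ofReal_add (by positivity) (by positivity)]
    refine ENNReal.ofReal_le_ofReal ?_
    set x := smod ξ ^ r * (φ (smod ξ))⁻¹ with hx
    set y := φ (smod ξ) * ‖g ξ‖ with hy
    have hx0 : 0 ≤ x := by positivity
    have hy0 : 0 ≤ y := by positivity
    have e1 : smod ξ ^ r * ‖g ξ‖ = x * y := by rw [hx, hy]; field_simp
    have e2 : smod ξ ^ (2 * r) * (φ (smod ξ))⁻¹ ^ 2 = x ^ 2 := by rw [hx]; ring
    have e3 : φ (smod ξ) ^ 2 * ‖g ξ‖ ^ 2 = y ^ 2 := by rw [hy]; ring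
    rw [e1, e2, e3]
    nlinarith [sq_nonneg (x - y)]
  · intro H
    by_contra hW
    rw [not_lt_top_iff] at hW
    obtain ⟨u, hum, hu0, hu2, hu1⟩ := exists_lintegral_sq_lt_top_lintegral_eq_top
      (volume.withDensity fun ξ : EuclideanSpace ℝ (Fin n) =>
        ENNReal.ofReal (smod ξ ^ (2 * r) * (φ (smod ξ))⁻¹ ^ 2))
      (by rw [withDensity_apply _ MeasurableSet.univ, Measure.restrict_univ, hW])
    rw [lintegral_withDensity_eq_lintegral_mul _ hWm (by fun_prop)] at hu1 hu2
    refine (H (fun ξ => ((u ξ * smod ξ ^ r * (φ (smod ξ))⁻¹ ^ 2 : ℝ) : ℂ)) (by fun_prop) ?_).ne ?_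
    all_goals
      have hnorm : ∀ ξ, ‖((u ξ * smod ξ ^ r * (φ (smod ξ))⁻¹ ^ 2 : ℝ) : ℂ)‖ =
          u ξ * smod ξ ^ r * (φ (smod ξ))⁻¹ ^ 2 := fun ξ => by
        have h1 := hs ξ
        have h3 := hu0 ξ
        rw [Complex.norm_real, Real.norm_of_nonneg (by positivity)]
      simp only [hnorm]
    · refine (lintegral_congr fun ξ => ?_).trans_lt hu2
      have h1 := hs ξ
      have h2 := hφs ξ
      rw [Pi.mul_apply, ← ENNReal.ofReal_mul (by positivity)]
      congr 1
      field_simp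
      ring
    · rw [← hu1]
      refine lintegral_congr fun ξ => ?_
      have h1 := hs ξ
      rw [Pi.mul_apply, ← ENNReal.ofReal_mul (by positivity)]
      congr 1
      ring
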